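/- Let d ≥ 1, let A < 0 be a real number, and let γ_d denote the standard Gaussian measure on ℝ^d. Then for all q, k ∈ ℝ^d, the expectation with respect to g ~ γ_d of (1 − 4A)^(d/2) · exp(2A‖g‖²) · exp(√(1 − 4A)·⟨g, q⟩) · exp(√(1 − 4A)·⟨g, k⟩) equals exp(‖q + k‖²/2). In particular, if ‖q‖ = ‖k‖ = r, this expectation equals exp(r²) · exp(⟨q, k⟩). -/

import Mathlib

open MeasureTheory ProbabilityTheory Real

/-- The standard Gaussian measure on `ℝ^d`: the product of `d` i.i.d. standard
normal `N(0,1)` measures. -/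
noncomputable def stdGaussian (d : ℕ) : Measure (Fin d → ℝ) :=
  Measure.pi fun _ => gaussianReal 0 1

/-- Tilting a standard normal by `s * exp ((1 - s²) x² / 2 + s c x)` turns it, up to the factor
`exp (c² / 2)`, into a normal of mean `c / s` and variance `1 / s²`. -/
theorem integral_exp_quadratic_gaussianReal {s : ℝ} (hs : 0 < s) (c : ℝ) :
    ∫ x, s * Real.exp ((1 - s ^ 2) / 2 * x ^ 2 + s * (x * c)) ∂(gaussianReal 0 1)
      = Real.exp (c ^ 2 / 2) := by
  obtain ⟨v, hvs⟩ : ∃ v : NNReal, (v : ℝ) = (s ^ 2)⁻¹ :=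
    ⟨Real.toNNReal (s ^ 2)⁻¹, Real.coe_toNNReal _ (by positivity)⟩
  have hv : v ≠ 0 := by
    rw [← NNReal.coe_ne_zero, hvs]
    positivity
  rw [integral_gaussianReal_eq_integral_smul one_ne_zero]
  have key : ∀ x : ℝ, gaussianPDFReal 0 1 x •
      (s * Real.exp ((1 - s ^ 2) / 2 * x ^ 2 + s * (x * c)))
      = Real.exp (c ^ 2 / 2) * gaussianPDFReal (c / s) v x := by
    intro x
    have hsqrt : (√(2 * π * (s ^ 2)⁻¹))⁻¹ = (√(2 * π))⁻¹ * s := by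
      rw [Real.sqrt_mul (by positivity), Real.sqrt_inv, Real.sqrt_sq hs.le, mul_inv, inv_inv]
    simp only [gaussianPDFReal, NNReal.coe_one, hvs, smul_eq_mul, hsqrt, mul_one]
    rw [mul_mul_mul_comm, ← Real.exp_add, mul_left_comm (Real.exp (c ^ 2 / 2)), ← Real.exp_add]
    congr 2
    field_simp
    ring
  simp_rw [key]
  rw [integral_const_mul, integral_gaussianPDFReal_eq_one _ hv, mul_one]

theorem integral_shifted_exponential_feature (d : ℕ) {A : ℝ} (hA : A < 0) (q k : Fin d → ℝ) :
    ∫ g, (1 - 4 * A) ^ ((d : ℝ) / 2) * Real.exp (2 * A * ∑ i, g i ^ 2)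
        * Real.exp (Real.sqrt (1 - 4 * A) * ∑ i, g i * q i)
        * Real.exp (Real.sqrt (1 - 4 * A) * ∑ i, g i * k i) ∂(stdGaussian d)
      = Real.exp ((∑ i, (q i + k i) ^ 2) / 2) := by
  have hpos : 0 < 1 - 4 * A := by linarith
  have hs : 0 < √(1 - 4 * A) := Real.sqrt_pos.mpr hpos
  have hsq : √(1 - 4 * A) ^ 2 = 1 - 4 * A := Real.sq_sqrt hpos.le
  have hpow : (1 - 4 * A) ^ ((d : ℝ) / 2) = √(1 - 4 * A) ^ d := by
    rw [Real.sqrt_eq_rpow, ← Real.rpow_mul_natCast hpos.le, one_div_mul_eq_div]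
  have key : ∀ g : Fin d → ℝ, (1 - 4 * A) ^ ((d : ℝ) / 2) * Real.exp (2 * A * ∑ i, g i ^ 2)
        * Real.exp (√(1 - 4 * A) * ∑ i, g i * q i)
        * Real.exp (√(1 - 4 * A) * ∑ i, g i * k i)
      = ∏ i, √(1 - 4 * A) * Real.exp ((1 - √(1 - 4 * A) ^ 2) / 2 * g i ^ 2
          + √(1 - 4 * A) * (g i * (q i + k i))) := by
    intro g
    rw [Finset.prod_mul_distrib, ← Real.exp_sum, Finset.prod_const, Finset.card_univ,
      Fintype.card_fin, hpow, hsq, mul_assoc, mul_assoc, ← Real.exp_add, ← Real.exp_add]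
    simp only [Finset.mul_sum, ← Finset.sum_add_distrib]
    congr 3 with i
    ring
  simp_rw [key]
  rw [_root_.stdGaussian, integral_fintype_prod_eq_prod (f := fun i x => √(1 - 4 * A) *
    Real.exp ((1 - √(1 - 4 * A) ^ 2) / 2 * x ^ 2 + √(1 - 4 * A) * (x * (q i + k i))))]
  simp_rw [integral_exp_quadratic_gaussianReal hs]
  rw [← Real.exp_sum, Finset.sum_div]

/-- Unbiasedness of the single shifted (FAVOR#-style) exponential random feature:
for `A < 0` and all `q, k ∈ ℝ^d`,
`𝔼_{g ∼ γ_d}[(1-4A)^(d/2)·exp(2A‖g‖²)·exp(√(1-4A)⟨g,q⟩)·exp(√(1-4A)⟨g,k⟩)]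
  = exp(‖q+k‖²/2)`;
in particular if `‖q‖ = ‖k‖ = r`, this expectation equals `exp(r²)·exp(⟨q,k⟩)`. -/
theorem shifted_exponential_feature_unbiased (d : ℕ) (hd : 1 ≤ d)
    (A : ℝ) (hA : A < 0) :
    (∀ q k : Fin d → ℝ,
      ∫ g, (1 - 4 * A) ^ ((d : ℝ) / 2) * Real.exp (2 * A * ∑ i, g i ^ 2)
          * Real.exp (Real.sqrt (1 - 4 * A) * ∑ i, g i * q i)
          * Real.exp (Real.sqrt (1 - 4 * A) * ∑ i, g i * k i) ∂(stdGaussian d)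
        = Real.exp ((∑ i, (q i + k i) ^ 2) / 2))
    ∧
    (∀ (q k : Fin d → ℝ) (r : ℝ),
      Real.sqrt (∑ i, q i ^ 2) = r → Real.sqrt (∑ i, k i ^ 2) = r →
      ∫ g, (1 - 4 * A) ^ ((d : ℝ) / 2) * Real.exp (2 * A * ∑ i, g i ^ 2)
          * Real.exp (Real.sqrt (1 - 4 * A) * ∑ i, g i * q i)
          * Real.exp (Real.sqrt (1 - 4 * A) * ∑ i, g i * k i) ∂(stdGaussian d)
        = Real.exp (r ^ 2) * Real.exp (∑ i, q i * k i)) := by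
  refine ⟨integral_shifted_exponential_feature d hA, fun q k r hq hk => ?_⟩
  rw [integral_shifted_exponential_feature d hA, ← Real.exp_add]
  have hq2 : ∑ i, q i ^ 2 = r ^ 2 := by
    rw [← hq, Real.sq_sqrt (Finset.sum_nonneg fun i _ => sq_nonneg _)]
  have hk2 : ∑ i, k i ^ 2 = r ^ 2 := by
    rw [← hk, Real.sq_sqrt (Finset.sum_nonneg fun i _ => sq_nonneg _)]
  have hsum : ∑ i, (q i + k i) ^ 2 = ∑ i, q i ^ 2 + 2 * ∑ i, q i * k i + ∑ i, k i ^ 2 := by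
    simp only [Finset.mul_sum, ← Finset.sum_add_distrib]
    exact Finset.sum_congr rfl fun i _ => by ring
  congr 1
  rw [hsum, hq2, hk2]
  ring
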